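/- arXiv:1612.04689 — 11 statements merged into one kernel-verified Lean document; each statement's English description precedes it below -/
import Mathlib

section
/- Let x be primal feasible, let (y, s) be dual feasible, and suppose that for some index a one has s_a > xᵀs. Then every integral primal optimal solution x*, i.e., every x* ∈ ℤ^m that is primal feasible and primal optimal for cost vector c, satisfies x*_a = 0. (Lemma 2.4, first part, for integral optimal solutions.) -/
open Matrix in
/-- The cost of a solution of `A x = b` splits as `bᵀy + xᵀs` when `Aᵀy + s = c`. -/
theorem cost_eq_dual_value_add_slack {ι κ R : Type*} [Fintype ι] [Fintype κ] [CommRing R]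
    {A : Matrix ι κ R} {b y : ι → R} {c s x : κ → R}
    (hx : A *ᵥ x = b) (hd : Aᵀ *ᵥ y + s = c) :
    c ⬝ᵥ x = b ⬝ᵥ y + x ⬝ᵥ s := by
  rw [← hd, ← hx, add_dotProduct, mulVec_transpose, ← dotProduct_mulVec,
    dotProduct_comm y, dotProduct_comm s]

/-- Lemma 2.4, first part: if `s a > xᵀs` for primal feasible `x` and dual feasible
`(y, s)`, then every integral primal optimal solution `xstar` satisfies `xstar a = 0`. -/
theorem stmt_2 (n m : ℕ) (hn : 1 ≤ n) (hm : 1 ≤ m)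
    (A : Matrix (Fin n) (Fin m) ℝ) (b : Fin n → ℝ) (c : Fin m → ℝ)
    (x : Fin m → ℝ) (hx_eq : A.mulVec x = b) (hx_nn : ∀ i, 0 ≤ x i)
    (y : Fin n → ℝ) (s : Fin m → ℝ)
    (hd_eq : A.transpose.mulVec y + s = c) (hd_nn : ∀ i, 0 ≤ s i)
    (a : Fin m) (ha : ∑ i, x i * s i < s a)
    (xstar : Fin m → ℝ) (hint : ∀ i, ∃ z : ℤ, xstar i = (z : ℝ))
    (hxs_eq : A.mulVec xstar = b) (hxs_nn : ∀ i, 0 ≤ xstar i)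
    (hxs_opt : ∀ x' : Fin m → ℝ, A.mulVec x' = b → (∀ i, 0 ≤ x' i) →
      ∑ i, c i * xstar i ≤ ∑ i, c i * x' i) :
    xstar a = 0 := by
  have hle : ∑ i, xstar i * s i ≤ ∑ i, x i * s i := by
    have hopt : c ⬝ᵥ xstar ≤ c ⬝ᵥ x := hxs_opt x hx_eq hx_nn
    rw [cost_eq_dual_value_add_slack hxs_eq hd_eq, cost_eq_dual_value_add_slack hx_eq hd_eq] at hopt
    exact le_of_add_le_add_left hopt
  have hterm : xstar a * s a ≤ ∑ i, xstar i * s i :=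
    Finset.single_le_sum (f := fun i => xstar i * s i)
      (fun i _ => mul_nonneg (hxs_nn i) (hd_nn i)) (Finset.mem_univ a)
  have hlt : xstar a < 1 := by
    by_contra! h
    linarith [le_mul_of_one_le_left (hd_nn a) h]
  have hnn := hxs_nn a
  obtain ⟨z, hz⟩ := hint a
  rw [hz] at hlt hnn ⊢
  norm_cast at hlt hnn ⊢
  lia
end

section
/- Let x be primal feasible, let (y, s) be dual feasible, and suppose that for some index a one has x_a > xᵀs. Then every integral dual optimal solution, i.e., every dual feasible (y*, s*) with s* ∈ ℤ^m that is dual optimal, satisfies s*_a = 0. (Lemma 2.4, second part, for integral optimal solutions.) -/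
open Matrix in
/-- The duality gap identity: if `Ax = b` and `Aᵀy + s = c`, then `xᵀs = xᵀc - bᵀy`. -/
theorem dotProduct_slack_eq_sub {ι κ R : Type*} [Fintype ι] [Fintype κ] [CommRing R]
    {A : Matrix ι κ R} {b : ι → R} {c x s : κ → R} {y : ι → R}
    (hx : A *ᵥ x = b) (hd : Aᵀ *ᵥ y + s = c) :
    x ⬝ᵥ s = x ⬝ᵥ c - b ⬝ᵥ y := by
  rw [← hd, ← hx, dotProduct_add, dotProduct_mulVec, vecMul_transpose, add_sub_cancel_left]

/-- Lemma 2.4, second part: if `x a > xᵀs` for primal feasible `x` and dual feasible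
`(y, s)`, then every integral dual optimal solution `(ystar, sstar)` satisfies
`sstar a = 0`. -/
theorem stmt_3 (n m : ℕ) (hn : 1 ≤ n) (hm : 1 ≤ m)
    (A : Matrix (Fin n) (Fin m) ℝ) (b : Fin n → ℝ) (c : Fin m → ℝ)
    (x : Fin m → ℝ) (hx_eq : A.mulVec x = b) (hx_nn : ∀ i, 0 ≤ x i)
    (y : Fin n → ℝ) (s : Fin m → ℝ)
    (hd_eq : A.transpose.mulVec y + s = c) (hd_nn : ∀ i, 0 ≤ s i)
    (a : Fin m) (ha : ∑ i, x i * s i < x a)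
    (ystar : Fin n → ℝ) (sstar : Fin m → ℝ)
    (hint : ∀ i, ∃ z : ℤ, sstar i = (z : ℝ))
    (hds_eq : A.transpose.mulVec ystar + sstar = c) (hds_nn : ∀ i, 0 ≤ sstar i)
    (hds_opt : ∀ (y' : Fin n → ℝ) (s' : Fin m → ℝ),
      A.transpose.mulVec y' + s' = c → (∀ i, 0 ≤ s' i) →
      ∑ i, b i * y' i ≤ ∑ i, b i * ystar i) :
    sstar a = 0 := by
  have gap_le : ∑ i, x i * sstar i ≤ ∑ i, x i * s i := by
    have h := dotProduct_slack_eq_sub hx_eq hd_eq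
    have hstar := dotProduct_slack_eq_sub hx_eq hds_eq
    have hopt := hds_opt y s hd_eq hd_nn
    simp only [dotProduct] at h hstar
    linarith
  have term_le : x a * sstar a ≤ ∑ i, x i * sstar i :=
    Finset.single_le_sum (f := fun i => x i * sstar i)
      (fun i _ => mul_nonneg (hx_nn i) (hds_nn i)) (Finset.mem_univ a)
  by_contra hne
  have one_le : 1 ≤ sstar a := by
    have hpos := lt_of_le_of_ne (hds_nn a) (Ne.symm hne)
    obtain ⟨z, hz⟩ := hint a
    rw [hz] at hpos ⊢
    exact_mod_cast Int.cast_pos.mp hpos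
  have := le_mul_of_one_le_right (hx_nn a) one_le
  linarith
end

section
/- Suppose x, s are δ-close to the central path at μ and set ε := (1−δ)/(1+δ). If x_{a₀} < ε/m for some index a₀ ∈ A, then s_{a₀} > Σ_{a∈A} x_a s_a. (Deletion criterion: an arc whose primal value is tiny has reduced cost exceeding the duality gap.) -/
/-- Deletion criterion: if `x, s` are δ-close to the central path at `μ` and
`x a₀ < ε/m` with `ε = (1-δ)/(1+δ)`, then `s a₀` exceeds the duality gap `Σ x_a s_a`. -/
theorem stmt_4 (ι : Type*) [Fintype ι] [Nonempty ι]
    (μ δ : ℝ) (hμ : 0 < μ) (hδ0 : 0 ≤ δ) (hδ1 : δ < 1)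
    (x s : ι → ℝ) (hx : ∀ a, 0 ≤ x a) (hs : ∀ a, 0 ≤ s a)
    (hclose : ∑ a, |x a * s a / μ - 1| ≤ δ)
    (a₀ : ι) (hsmall : x a₀ < ((1 - δ) / (1 + δ)) / (Fintype.card ι : ℝ)) :
    ∑ a, x a * s a < s a₀ := by
  set m : ℝ := (Fintype.card ι : ℝ) with hm
  have hm1 : 1 ≤ m := by
    rw [hm]
    exact_mod_cast Fintype.card_pos (α := ι)
  have hgap : ∑ a, x a * s a ≤ μ * (m * (1 + δ)) := by
    have hsum : ∑ a, (x a * s a / μ - 1) ≤ δ :=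
      (Finset.sum_le_sum fun a _ => le_abs_self _).trans hclose
    rw [Finset.sum_sub_distrib, ← Finset.sum_div, Finset.sum_const, Finset.card_univ,
      nsmul_eq_mul, mul_one, ← hm] at hsum
    have hdiv : (∑ a, x a * s a) / μ ≤ m * (1 + δ) := by nlinarith
    rwa [div_le_iff₀' hμ] at hdiv
  have hprod : μ * (1 - δ) ≤ x a₀ * s a₀ := by
    have habs : |x a₀ * s a₀ / μ - 1| ≤ δ :=
      (Finset.single_le_sum (f := fun a => |x a * s a / μ - 1|)
        (fun _ _ => abs_nonneg _) (Finset.mem_univ a₀)).trans hclose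
    have hdiv : 1 - δ ≤ x a₀ * s a₀ / μ := by linarith [(abs_le.mp habs).1]
    rwa [le_div_iff₀' hμ] at hdiv
  have hxm : x a₀ * (m * (1 + δ)) < 1 - δ := by
    rw [div_div, lt_div_iff₀ (by positivity)] at hsmall
    linarith
  refine hgap.trans_lt (lt_of_mul_lt_mul_left ?_ (hx a₀))
  calc x a₀ * (μ * (m * (1 + δ))) = μ * (x a₀ * (m * (1 + δ))) := by ring
    _ < μ * (1 - δ) := mul_lt_mul_of_pos_left hxm hμ
    _ ≤ x a₀ * s a₀ := hprod
end

section
/- Suppose x, s are δ-close to the central path at μ and set ε := (1−δ)/(1+δ). If s_{a₀} < ε/m for some index a₀ ∈ A, then x_{a₀} > Σ_{a∈A} x_a s_a. (Contraction criterion: an arc whose reduced cost is tiny has primal value exceeding the duality gap.) -/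
/-- Contraction criterion: if `x, s` are δ-close to the central path at `μ` and
`s a₀ < ε/m` with `ε = (1-δ)/(1+δ)`, then `x a₀` exceeds the duality gap `Σ x_a s_a`. -/
theorem stmt_5 (ι : Type*) [Fintype ι] [Nonempty ι]
    (μ δ : ℝ) (hμ : 0 < μ) (hδ0 : 0 ≤ δ) (hδ1 : δ < 1)
    (x s : ι → ℝ) (hx : ∀ a, 0 ≤ x a) (hs : ∀ a, 0 ≤ s a)
    (hclose : ∑ a, |x a * s a / μ - 1| ≤ δ)
    (a₀ : ι) (hsmall : s a₀ < ((1 - δ) / (1 + δ)) / (Fintype.card ι : ℝ)) :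
    ∑ a, x a * s a < x a₀ := by
  have hterm : ∀ a, |x a * s a / μ - 1| ≤ δ := fun a =>
    (Finset.single_le_sum (f := fun a => |x a * s a / μ - 1|)
      (fun _ _ => abs_nonneg _) (Finset.mem_univ a)).trans hclose
  have hupper : ∀ a, x a * s a ≤ (1 + δ) * μ := fun a => by
    rw [← div_le_iff₀ hμ]
    linarith [(abs_le.mp (hterm a)).2]
  have hlower : (1 - δ) * μ ≤ x a₀ * s a₀ := by
    rw [← le_div_iff₀ hμ]
    linarith [(abs_le.mp (hterm a₀)).1]
  have hgap : ∑ a, x a * s a ≤ Fintype.card ι * ((1 + δ) * μ) := by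
    simpa using Finset.sum_le_card_nsmul Finset.univ _ _ (fun a _ => hupper a)
  have hcard : (0 : ℝ) < Fintype.card ι := by exact_mod_cast Fintype.card_pos
  have hδ : 0 < 1 - δ := by linarith
  have hδ' : 0 < 1 + δ := by linarith
  have hsmall' : s a₀ * Fintype.card ι * (1 + δ) < 1 - δ := by
    rwa [lt_div_iff₀ hcard, lt_div_iff₀ hδ'] at hsmall
  have hx₀ : 0 < x a₀ :=
    pos_of_mul_pos_left ((mul_pos hδ hμ).trans_le hlower) (hs a₀)
  refine hgap.trans_lt (lt_of_mul_lt_mul_left ?_ hδ.le)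
  calc (1 - δ) * (Fintype.card ι * ((1 + δ) * μ))
      = (1 - δ) * μ * (Fintype.card ι * (1 + δ)) := by ring
    _ ≤ x a₀ * s a₀ * (Fintype.card ι * (1 + δ)) := by gcongr
    _ = x a₀ * (s a₀ * Fintype.card ι * (1 + δ)) := by ring
    _ < x a₀ * (1 - δ) := by gcongr
    _ = (1 - δ) * x a₀ := mul_comm _ _
end

section
/- Let x, s, μ' be positive reals and let Δx, Δs, e be reals with e > −1 such that s·Δx + x·Δs + x·s = (1+e)·μ'. If (x+Δx)(s+Δs) > 0, then x + Δx > 0 and s + Δs > 0. (Per-arc positivity of the Newton-type update in the centering step: closeness of the new iterate to the central path forces both updated coordinates to stay positive.) -/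
/-- Per-arc positivity of the Newton-type update: if
`s·Δx + x·Δs + x·s = (1+e)·μ'` with `e > -1` and `(x+Δx)(s+Δs) > 0`,
then both updated coordinates stay positive. -/
theorem stmt_8 (x s μ' Δx Δs e : ℝ) (hx : 0 < x) (hs : 0 < s) (hμ : 0 < μ')
    (he : -1 < e) (heq : s * Δx + x * Δs + x * s = (1 + e) * μ')
    (hpos : 0 < (x + Δx) * (s + Δs)) : 0 < x + Δx ∧ 0 < s + Δs := by
  refine (pos_and_pos_or_neg_and_neg_of_mul_pos hpos).resolve_right ?_
  rintro ⟨hx', hs'⟩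
  have hrhs : 0 < (1 + e) * μ' := mul_pos (by linarith) hμ
  have hsx : s * (x + Δx) < 0 := mul_neg_of_pos_of_neg hs hx'
  have hxs : x * (s + Δs) < 0 := mul_neg_of_pos_of_neg hx hs'
  linarith [mul_pos hx hs]
end

section
/- Let 0 < δ ≤ 1/8, let τ' be a real with 0 ≤ τ' ≤ δ and τ'·√m ≤ δ, and set μ' := (1−τ')μ. Suppose: (i) x, s are δ-close to the central path at μ; (ii) Σ_{a∈A} Δx_a·Δs_a = 0 (orthogonality of the primal and dual updates); and (iii) the relative residuals ε̂_a := (s_a·Δx_a + x_a·Δs_a + x_a·s_a − μ')/μ' satisfy Σ_{a∈A} |ε̂_a| ≤ δ/4. Then Σ_{a∈A} |(x_a+Δx_a)(s_a+Δs_a)/μ' − 1| ≤ δ, i.e., the updated iterates x+Δx, s+Δs are δ-close to the central path at μ'. (Lemma 3.3.) -/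
/-- The product of two step components is controlled by the square of the linearized change of
`x * s`, up to the product itself. -/
lemma two_mul_abs_mul_add_le {x s d e : ℝ} (hx : 0 < x) (hs : 0 < s) :
    2 * |d * e| + 2 * (d * e) ≤ (s * d + x * e) ^ 2 / (x * s) := by
  have hw : 0 < x * s := mul_pos hx hs
  rw [le_div_iff₀ hw]
  rcases abs_cases (d * e) with ⟨h, _⟩ | ⟨h, _⟩ <;> rw [h] <;>
    nlinarith [sq_nonneg (s * d - x * e), sq_nonneg (s * d + x * e)]

/-- Bound on the squared linearized change, relative to `x * s = μ * (1 + e)`. -/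
lemma sq_div_le_of_residual {μ t e r : ℝ} (hμ : 0 < μ) (ht0 : 0 ≤ t) (ht : t ≤ 1 / 8)
    (he : |e| ≤ 1 / 8) :
    (μ * ((1 - t) * r - t - e)) ^ 2 / (μ * (1 + e)) ≤
      (1 - t) * μ * (4 * (r ^ 2 + t ^ 2 + e ^ 2)) := by
  obtain ⟨he1, -⟩ := abs_le.mp he
  rw [div_le_iff₀ (mul_pos hμ (by linarith))]
  have hden : 3 / 4 ≤ (1 - t) * (1 + e) := by nlinarith
  have hr : ((1 - t) * r) ^ 2 ≤ r ^ 2 := by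
    rw [mul_pow]
    exact mul_le_of_le_one_left (sq_nonneg r) (by nlinarith)
  have hsq : ((1 - t) * r - t - e) ^ 2 ≤ 3 * (r ^ 2 + t ^ 2 + e ^ 2) := by
    nlinarith [sq_nonneg ((1 - t) * r + t), sq_nonneg ((1 - t) * r + e), sq_nonneg (t - e)]
  have hS : 0 ≤ r ^ 2 + t ^ 2 + e ^ 2 := by positivity
  calc (μ * ((1 - t) * r - t - e)) ^ 2 = μ ^ 2 * ((1 - t) * r - t - e) ^ 2 := by ring
    _ ≤ μ ^ 2 * (((1 - t) * (1 + e)) * (4 * (r ^ 2 + t ^ 2 + e ^ 2))) := by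
        gcongr
        nlinarith [mul_le_mul_of_nonneg_right hden hS]
    _ = _ := by ring

/-- The squared `ℓ²` norm is at most the square of any bound on the `ℓ¹` norm. -/
lemma sum_sq_le_sq_of_sum_abs_le {ι : Type*} [Fintype ι] {f : ι → ℝ} {c : ℝ}
    (h : ∑ a, |f a| ≤ c) : ∑ a, f a ^ 2 ≤ c ^ 2 := by
  calc ∑ a, f a ^ 2 = ∑ a, |f a| ^ 2 := by simp
    _ ≤ (∑ a, |f a|) ^ 2 := Finset.sum_sq_le_sq_sum_of_nonneg fun a _ => abs_nonneg (f a)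
    _ ≤ c ^ 2 := by gcongr

/-- Lemma 3.3: if `x, s` are δ-close to the central path at `μ`, the updates are
orthogonal, and the relative residuals at `μ' = (1-τ')μ` have ℓ₁-norm at most δ/4,
then the updated iterates are δ-close to the central path at `μ'`. -/
theorem stmt_9 (ι : Type*) [Fintype ι] [Nonempty ι]
    (μ δ τ' μ' : ℝ) (hμ : 0 < μ) (hδ0 : 0 < δ) (hδ : δ ≤ 1/8)
    (hτ0 : 0 ≤ τ') (hτδ : τ' ≤ δ)
    (hτm : τ' * Real.sqrt (Fintype.card ι : ℝ) ≤ δ)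
    (hμ' : μ' = (1 - τ') * μ)
    (x s Δx Δs : ι → ℝ) (hx : ∀ a, 0 < x a) (hs : ∀ a, 0 < s a)
    (hclose : ∑ a, |x a * s a / μ - 1| ≤ δ)
    (horth : ∑ a, Δx a * Δs a = 0)
    (hres : ∑ a, |(s a * Δx a + x a * Δs a + x a * s a - μ') / μ'| ≤ δ / 4) :
    ∑ a, |(x a + Δx a) * (s a + Δs a) / μ' - 1| ≤ δ := by
  have hμ'0 : 0 < μ' := by rw [hμ']; exact mul_pos (by linarith) hμ
  set r : ι → ℝ := fun a => (s a * Δx a + x a * Δs a + x a * s a - μ') / μ' with hr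
  set e : ι → ℝ := fun a => x a * s a / μ - 1 with he
  have hpoint (a : ι) : 2 * (|Δx a * Δs a| / μ') + 2 * (Δx a * Δs a / μ') ≤
      4 * (r a ^ 2 + τ' ^ 2 + e a ^ 2) := by
    have hea : |e a| ≤ 1 / 8 :=
      (Finset.single_le_sum (f := fun a => |e a|) (fun _ _ => abs_nonneg _)
        (Finset.mem_univ a)).trans (hclose.trans hδ)
    have hw : x a * s a = μ * (1 + e a) := by simp only [he]; field_simp; ring
    have hlin : s a * Δx a + x a * Δs a = μ * ((1 - τ') * r a - τ' - e a) := by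
      have h : μ' * r a = s a * Δx a + x a * Δs a + x a * s a - μ' := by
        simp only [hr]; field_simp
      rw [hw, hμ'] at h
      linarith
    have h := two_mul_abs_mul_add_le (d := Δx a) (e := Δs a) (hx a) (hs a)
    rw [hlin, hw] at h
    have h' := h.trans (sq_div_le_of_residual hμ hτ0 (hτδ.trans hδ) hea)
    rw [← hμ'] at h'
    calc 2 * (|Δx a * Δs a| / μ') + 2 * (Δx a * Δs a / μ')
        = (2 * |Δx a * Δs a| + 2 * (Δx a * Δs a)) / μ' := by ring
      _ ≤ _ := (div_le_iff₀' hμ'0).mpr h'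
  have hτsum : ∑ _a : ι, τ' ^ 2 ≤ δ ^ 2 := by
    calc ∑ _a : ι, τ' ^ 2 = (τ' * Real.sqrt (Fintype.card ι : ℝ)) ^ 2 := by
          rw [mul_pow, Real.sq_sqrt (Nat.cast_nonneg _)]
          simp [mul_comm]
      _ ≤ δ ^ 2 := by gcongr
  have hsum := Finset.sum_le_sum fun a (_ : a ∈ Finset.univ) => hpoint a
  simp only [Finset.sum_add_distrib, ← Finset.mul_sum] at hsum
  rw [← Finset.sum_div _ (fun a => Δx a * Δs a), horth, zero_div] at hsum
  have hr2 : ∑ a, r a ^ 2 ≤ (δ / 4) ^ 2 := sum_sq_le_sq_of_sum_abs_le hres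
  have he2 : ∑ a, e a ^ 2 ≤ δ ^ 2 := sum_sq_le_sq_of_sum_abs_le hclose
  have hstep : ∑ a, |Δx a * Δs a| / μ' ≤ 3 / 4 * δ := by nlinarith
  have hres' : ∑ a, |r a| ≤ δ / 4 := hres
  calc ∑ a, |(x a + Δx a) * (s a + Δs a) / μ' - 1|
      ≤ ∑ a, (|r a| + |Δx a * Δs a| / μ') := by
        refine Finset.sum_le_sum fun a _ => ?_
        have h : (x a + Δx a) * (s a + Δs a) / μ' - 1 = r a + Δx a * Δs a / μ' := by
          simp only [hr]; field_simp; ring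
        rw [h]
        refine (abs_add_le _ _).trans_eq ?_
        rw [abs_div (Δx a * Δs a), abs_of_pos hμ'0]
    _ = ∑ a, |r a| + ∑ a, |Δx a * Δs a| / μ' := Finset.sum_add_distrib
    _ ≤ δ := by linarith
end

section
/- Let 0 < δ ≤ 1/8, let τ' be a real with 0 ≤ τ' ≤ δ, and set μ' := (1−τ')μ. Suppose for every a ∈ A: (1−δ)μ ≤ x_a s_a ≤ (1+δ)μ, the resistance r_a satisfies s_a/x_a ≤ r_a ≤ 2 s_a/x_a, and ρ_a satisfies μ'/(2 s_a) ≤ ρ_a ≤ 2 μ'/s_a. Define the initial current φ⁰_a := x_a − ρ_a. Then the initial electrical energy satisfies Σ_{a∈A} r_a (φ⁰_a)² ≤ 10·μ·m. (Energy bound for the initial flow in the centering step, formula (10) of the paper.) -/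
/-- Energy bound for the initial flow in the centering step (formula (10)):
`Σ r_a (φ⁰_a)² ≤ 10 μ m` for `φ⁰_a = x_a - ρ_a`. -/
theorem stmt_10 (ι : Type*) [Fintype ι] [Nonempty ι]
    (μ δ τ' μ' : ℝ) (hμ : 0 < μ) (hδ0 : 0 < δ) (hδ : δ ≤ 1/8)
    (hτ0 : 0 ≤ τ') (hτ : τ' ≤ δ) (hμ' : μ' = (1 - τ') * μ)
    (x s r ρ : ι → ℝ) (hx : ∀ a, 0 < x a) (hs : ∀ a, 0 < s a)
    (hxs1 : ∀ a, (1 - δ) * μ ≤ x a * s a) (hxs2 : ∀ a, x a * s a ≤ (1 + δ) * μ)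
    (hr1 : ∀ a, s a / x a ≤ r a) (hr2 : ∀ a, r a ≤ 2 * (s a / x a))
    (hρ1 : ∀ a, μ' / (2 * s a) ≤ ρ a) (hρ2 : ∀ a, ρ a ≤ 2 * μ' / s a) :
    ∑ a, r a * (x a - ρ a) ^ 2 ≤ 10 * μ * (Fintype.card ι : ℝ) := by
  have hμ'0 : 0 ≤ μ' := by rw [hμ']; exact mul_nonneg (by linarith) hμ.le
  have hμ'μ : μ' ≤ μ := by rw [hμ']; nlinarith
  have energy_le : ∀ a, r a * (x a - ρ a) ^ 2 ≤ 10 * μ := by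
    intro a
    have hxa := hx a
    have hsa := hs a
    have hp1 : 7 / 8 * μ ≤ x a * s a := le_trans (by nlinarith) (hxs1 a)
    have hp2 : x a * s a ≤ 9 / 8 * μ := (hxs2 a).trans (by nlinarith)
    have hρ0 : 0 ≤ ρ a := le_trans (by positivity) (hρ1 a)
    have hq0 : 0 ≤ ρ a * s a := by positivity
    have hq : ρ a * s a ≤ 2 * μ' := (le_div_iff₀ hsa).1 (hρ2 a)
    have hsq : (x a * s a - ρ a * s a) ^ 2 ≤ (9 / 8 * μ) ^ 2 :=
      sq_le_sq' (by linarith) (by linarith)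
    calc r a * (x a - ρ a) ^ 2
        ≤ 2 * (s a / x a) * (x a - ρ a) ^ 2 :=
          mul_le_mul_of_nonneg_right (hr2 a) (sq_nonneg _)
      _ = 2 * (x a * s a - ρ a * s a) ^ 2 / (x a * s a) := by field_simp
      _ ≤ 10 * μ := by
          rw [div_le_iff₀ (by positivity)]
          nlinarith
  calc ∑ a, r a * (x a - ρ a) ^ 2
      ≤ ∑ _a : ι, 10 * μ := Finset.sum_le_sum fun a _ => energy_le a
    _ = 10 * μ * (Fintype.card ι : ℝ) := by
        simp [mul_comm]
end

section
/- Set δ := 1/8 and ε := (1−δ)/(1+δ) = 7/9. Let β, γ, U, C be reals with U ≥ 1, C ≥ 1, β ≥ 2⁸m³, and γ ≥ 2¹⁵m⁴βUC, let 0 < μ ≤ 24mβγUC, let τ' be a real with 0 ≤ τ' ≤ δ, and set μ' := (1−τ')μ. Suppose for every a ∈ A: εβ/m ≤ x_a ≤ (1+δ)μm/(εγ), εγ/m ≤ s_a ≤ (1+δ)μm/(εβ), (1−δ)μ ≤ x_a s_a ≤ (1+δ)μ, x_a ≤ s_a, and s_a ≤ μ'. Define r_a := ⌈s_a/x_a⌉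 (ceiling) and φ⁰_a := x_a − round(μ'/s_a) (rounding to the nearest integer). Let φ, g ∈ ℝ^A satisfy Σ_{a∈A} r_a φ_a² ≤ Σ_{a∈A} r_a (φ⁰_a)² (the energy of φ does not exceed that of φ⁰) and Σ_{a∈A} (r_a φ_a − g_a)²/r_a < 2⁻¹⁴ μ/m_H (small duality gap of the electrical flow). Define Δx_a := φ_a − φ⁰_a and Δs_a := −g_a. Then Σ_{a∈A} |(s_a Δx_a + x_a Δs_a + x_a s_a)/μ' − 1| ≤ δ/4. (Lemma 3.2: a small gap of the approximate electrical flow yields a small relative residual of the centering update.) -/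
/-- Weighted AM-GM bound for a product, with weight `k * r`. -/
lemma abs_mul_le_weighted {r k : ℝ} (hr : 0 < r) (hk : 0 < k) (u v : ℝ) :
    |u * v| ≤ k * (v ^ 2 / r) / 2 + r * u ^ 2 / (2 * k) := by
  have key : k * (v ^ 2 / r) / 2 + r * u ^ 2 / (2 * k) - |u| * |v| =
      (k * |v| - r * |u|) ^ 2 / (2 * k * r) := by
    rw [← sq_abs u, ← sq_abs v]
    field_simp
    ring
  have : 0 ≤ (k * |v| - r * |u|) ^ 2 / (2 * k * r) := by positivity
  rw [abs_mul]
  linarith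

/-- Decomposition of the centering residual into the duality gap term, the error from rounding
up the resistance, and the error from rounding the initial flow. -/
lemma abs_residual_le {x s r φ φ0 g μ' q N : ℝ} (hx : 0 < x) (hN : 0 < N) (hs : 0 < s)
    (hr : 0 < r) (hr1 : s ≤ x * r) (hr2 : x * r ≤ s + x) (hq : |μ' / s - q| ≤ 1 / 2)
    (hφ0 : φ0 = x - q) :
    |s * (φ - φ0) + x * -g + x * s - μ'| ≤
      (96 * N * ((r * φ - g) ^ 2 / r) + r * x ^ 2 / (384 * N)) +
      (r * φ ^ 2 / (1000 * N) + 250 * N * (x ^ 2 / r)) + s / 2 := by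
  have h1 := abs_mul_le_weighted hr (show 0 < 192 * N by positivity) x (r * φ - g)
  have h2 := abs_mul_le_weighted hr (show 0 < 500 * N by positivity) φ x
  have h3 : |(s - x * r) * φ| ≤ |φ * x| := by
    rw [abs_mul, abs_mul, mul_comm |φ|, abs_of_pos hx]
    exact mul_le_mul_of_nonneg_right (abs_le.2 ⟨by linarith, by linarith⟩) (abs_nonneg _)
  have h4 : |s * q - μ'| ≤ s / 2 := by
    have : s * q - μ' = -(s * (μ' / s - q)) := by field_simp; ring
    rw [this, abs_neg, abs_mul, abs_of_pos hs]
    linarith [mul_le_mul_of_nonneg_left hq hs.le]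
  have h5 : s * (φ - φ0) + x * -g + x * s - μ' =
      x * (r * φ - g) + (s - x * r) * φ + (s * q - μ') := by rw [hφ0]; ring
  rw [h5]
  have h6 := abs_add_three (x * (r * φ - g)) ((s - x * r) * φ) (s * q - μ')
  ring_nf at h1 h2 h3 h4 h6 ⊢
  linarith

/-- The initial flow deviates from `0` by at most half of `x`. -/
lemma abs_initial_flow_le {x s μ μ' q : ℝ} (hs : 0 < s)
    (hx : 199 ≤ x) (hl : 7 / 8 * μ ≤ x * s) (hu : x * s ≤ 9 / 8 * μ)
    (hl' : 7 / 8 * μ ≤ μ') (hu' : μ' ≤ μ) (hq : |μ' / s - q| ≤ 1 / 2) :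
    |x - q| ≤ x / 2 := by
  have h1 : μ' / s ≤ 8 / 7 * x := by rw [div_le_iff₀ hs]; linarith
  have h2 : 7 / 9 * x ≤ μ' / s := by rw [le_div_iff₀ hs]; linarith
  rw [abs_le] at hq ⊢
  constructor <;> linarith [hq.1, hq.2]

/-- The slack is larger than the flow by a factor linear in `m`. -/
lemma flow_le_slack {m β γ V μ x s : ℝ} (hm : 1 ≤ m) (hβ : 0 < β) (hγ0 : 0 < γ) (hV : 0 < V)
    (hγ : 2 ^ 15 * m ^ 4 * (β * V) ≤ γ) (hμ : μ ≤ 24 * m * (β * V) * γ)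
    (hx : x ≤ (1 + 1 / 8) * μ * m / (7 / 9 * γ)) (hs : 7 / 9 * γ / m ≤ s) :
    700 * m * x ≤ s := by
  have hm0 : 0 < m := by linarith
  have h1 : x ≤ 35 * m ^ 2 * (β * V) := by
    refine hx.trans ?_
    rw [div_le_iff₀ (by positivity)]
    have := mul_le_mul_of_nonneg_right hμ hm0.le
    have : 0 ≤ m ^ 2 * (β * V) * γ := by positivity
    nlinarith
  have h2 : 7 / 9 * (2 ^ 15 * m ^ 3 * (β * V)) ≤ s := by
    refine le_trans ?_ hs
    rw [le_div_iff₀ hm0]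
    nlinarith
  have := mul_le_mul_of_nonneg_left h1 (show 0 ≤ 700 * m by positivity)
  have : 0 ≤ m ^ 3 * (β * V) := by positivity
  nlinarith

/-- Lemma 3.2: with δ = 1/8, ε = 7/9, sufficiently large scalings β, γ, and a small
duality gap of the approximate electrical flow, the relative residual of the
centering update has ℓ₁-norm at most δ/4. -/
theorem stmt_11 (ι : Type*) [Fintype ι] [Nonempty ι] (m : ℕ) (hm : 1 ≤ m)
    (hcard : Fintype.card ι ≤ m)
    (β γ U C μ τ' μ' : ℝ)
    (hU : 1 ≤ U) (hC : 1 ≤ C)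
    (hβ : 2 ^ 8 * (m : ℝ) ^ 3 ≤ β) (hγ : 2 ^ 15 * (m : ℝ) ^ 4 * β * U * C ≤ γ)
    (hμ0 : 0 < μ) (hμub : μ ≤ 24 * (m : ℝ) * β * γ * U * C)
    (hτ0 : 0 ≤ τ') (hτ : τ' ≤ 1/8) (hμ' : μ' = (1 - τ') * μ)
    (x s : ι → ℝ) (hx : ∀ a, 0 < x a) (hs : ∀ a, 0 < s a)
    (hx1 : ∀ a, (7/9) * β / (m : ℝ) ≤ x a)
    (hx2 : ∀ a, x a ≤ (1 + 1/8) * μ * (m : ℝ) / ((7/9) * γ))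
    (hs1 : ∀ a, (7/9) * γ / (m : ℝ) ≤ s a)
    (hs2 : ∀ a, s a ≤ (1 + 1/8) * μ * (m : ℝ) / ((7/9) * β))
    (hxs1 : ∀ a, (1 - 1/8) * μ ≤ x a * s a)
    (hxs2 : ∀ a, x a * s a ≤ (1 + 1/8) * μ)
    (hxls : ∀ a, x a ≤ s a) (hsμ : ∀ a, s a ≤ μ')
    (r φ0 : ι → ℝ)
    (hr : ∀ a, r a = (⌈s a / x a⌉ : ℝ))
    (hφ0 : ∀ a, φ0 a = x a - (round (μ' / s a) : ℝ))
    (φ g : ι → ℝ)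
    (henergy : ∑ a, r a * (φ a) ^ 2 ≤ ∑ a, r a * (φ0 a) ^ 2)
    (hgap : ∑ a, (r a * φ a - g a) ^ 2 / r a <
      (2 : ℝ) ^ (-14 : ℤ) * μ / (Fintype.card ι : ℝ))
    (Δx Δs : ι → ℝ) (hΔx : ∀ a, Δx a = φ a - φ0 a) (hΔs : ∀ a, Δs a = -g a) :
    ∑ a, |(s a * Δx a + x a * Δs a + x a * s a) / μ' - 1| ≤ (1/8) / 4 := by
  have hm1 : (1 : ℝ) ≤ m := by exact_mod_cast hm
  have hm0 : (0 : ℝ) < m := by linarith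
  set N : ℝ := (Fintype.card ι : ℝ) with hNdef
  have hN0 : 0 < N := Nat.cast_pos.2 Fintype.card_pos
  have hNm : N ≤ m := Nat.cast_le.2 hcard
  have hβ0 : 0 < β := lt_of_lt_of_le (by positivity) hβ
  have hγ0 : 0 < γ := lt_of_lt_of_le (by positivity) hγ
  have hμl : 7 / 8 * μ ≤ μ' := by rw [hμ']; nlinarith
  have hμu : μ' ≤ μ := by rw [hμ']; nlinarith
  have hμ'0 : 0 < μ' := by linarith
  have hr1 : ∀ a, s a ≤ x a * r a := fun a => by
    have := Int.le_ceil (s a / x a)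
    rw [← hr, div_le_iff₀ (hx a)] at this
    linarith
  have hr2 : ∀ a, x a * r a ≤ s a + x a := fun a => by
    have := (Int.ceil_lt_add_one (s a / x a)).le
    rw [← hr] at this
    have h := mul_le_mul_of_nonneg_left this (hx a).le
    rwa [mul_add, mul_div_cancel₀ _ (hx a).ne', mul_one] at h
  have hr0 : ∀ a, 0 < r a := fun a =>
    pos_of_mul_pos_right ((hs a).trans_le (hr1 a)) (hx a).le
  have hrx : ∀ a, r a * x a ^ 2 ≤ 9 / 4 * μ := fun a => by
    nlinarith [mul_le_mul_of_nonneg_left (hr2 a) (hx a).le, hxs2 a,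
      mul_le_mul_of_nonneg_left (hxls a) (hx a).le]
  have hq : ∀ a, |μ' / s a - (round (μ' / s a) : ℝ)| ≤ 1 / 2 := fun a => abs_sub_round _
  have hx199 : ∀ a, 199 ≤ x a := fun a => by
    refine le_trans ?_ (hx1 a)
    rw [le_div_iff₀ hm0]
    nlinarith [pow_le_pow_right₀ hm1 (show 1 ≤ 3 by norm_num)]
  have hrφ0 : ∀ a, r a * φ0 a ^ 2 ≤ 9 / 16 * μ := fun a => by
    have h := abs_initial_flow_le (hs a) (hx199 a) (by linarith [hxs1 a])
      (by linarith [hxs2 a]) hμl hμu (hq a)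
    rw [← hφ0] at h
    have h2 : φ0 a ^ 2 ≤ (x a / 2) ^ 2 := sq_le_sq' (abs_le.1 h).1 (abs_le.1 h).2
    nlinarith [mul_le_mul_of_nonneg_left h2 (hr0 a).le, hrx a]
  have hxs : ∀ a, 700 * N * x a ≤ s a := fun a =>
    le_trans (by have := hx a; gcongr) (flow_le_slack (V := U * C) hm1 hβ0 hγ0 (by positivity)
      (by linarith) (by linarith) (hx2 a) (hs1 a))
  have hxr : ∀ a, 250 * N * (x a ^ 2 / r a) ≤ μ / 1000 / N := fun a => by
    have hNx : 0 ≤ 700 * N * x a := mul_nonneg (by positivity) (hx a).le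
    have h1 : (700 * N * x a) * (700 * N * x a) ≤ x a * r a * s a :=
      mul_le_mul ((hxs a).trans (hr1 a)) (hxs a) hNx (mul_pos (hx a) (hr0 a)).le
    have h2 : x a * r a * s a ≤ 9 / 8 * μ * r a := by
      linarith [mul_le_mul_of_nonneg_right (hxs2 a) (hr0 a).le]
    have h3 := h1.trans h2
    have h4 := mul_pos hμ0 (hr0 a)
    rw [le_div_iff₀ hN0, mul_div_assoc', div_mul_eq_mul_div, div_le_iff₀ (hr0 a)]
    nlinarith
  have hs350 : ∀ a, s a / 2 ≤ μ / 350 / N := fun a => by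
    have h1 : s a ≤ μ / 175 / m := by
      refine (hs2 a).trans ?_
      rw [div_div, div_le_div_iff₀ (by positivity) (by positivity)]
      have h2 : 256 * (m : ℝ) ^ 2 ≤ β :=
        le_trans (by nlinarith [pow_le_pow_right₀ hm1 (show 2 ≤ 3 by norm_num)]) hβ
      nlinarith [mul_le_mul_of_nonneg_left h2 hμ0.le]
    have h3 : μ / 175 / m ≤ μ / 175 / N := by gcongr
    have h4 : μ / 350 / N = μ / 175 / N / 2 := by ring
    linarith
  have hterm : ∀ a, |(s a * Δx a + x a * Δs a + x a * s a) / μ' - 1| ≤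
      (96 * N * ((r a * φ a - g a) ^ 2 / r a) + r a * φ a ^ 2 * (1 / (1000 * N)) +
        μ / 100 / N) / μ' := fun a => by
    have h := abs_residual_le (φ := φ a) (g := g a) (hx a) hN0 (hs a) (hr0 a) (hr1 a) (hr2 a)
      (hq a) (hφ0 a)
    rw [div_sub_one hμ'0.ne', abs_div, abs_of_pos hμ'0, hΔx, hΔs]
    gcongr
    refine h.trans ?_
    have h1 : r a * x a ^ 2 / (384 * N) ≤ 9 / 4 * μ / (384 * N) :=
      div_le_div_of_nonneg_right (hrx a) (by positivity)
    have h2 : 9 / 4 * μ / (384 * N) = 3 / 512 * (μ / N) := by field_simp; ring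
    have h3 : 0 < μ / N := by positivity
    have h4 := hxr a
    have h5 := hs350 a
    rw [div_right_comm] at h4 h5 ⊢
    rw [mul_one_div]
    linarith
  refine (Finset.sum_le_sum fun a _ => hterm a).trans ?_
  rw [← Finset.sum_div, Finset.sum_add_distrib, Finset.sum_add_distrib, ← Finset.mul_sum,
    ← Finset.sum_mul, Finset.sum_const, Finset.card_univ, nsmul_eq_mul, ← hNdef,
    mul_div_cancel₀ _ hN0.ne', div_le_iff₀ hμ'0]
  have hφ : ∑ a, r a * φ a ^ 2 ≤ N * (9 / 16 * μ) := by
    refine henergy.trans ((Finset.sum_le_sum fun a _ => hrφ0 a).trans_eq ?_)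
    rw [Finset.sum_const, Finset.card_univ, nsmul_eq_mul]
  have hE : (∑ a, r a * φ a ^ 2) * (1 / (1000 * N)) ≤ 9 / 16000 * μ := by
    rw [mul_one_div, div_le_iff₀ (by positivity)]
    linarith
  have hG : 96 * N * ∑ a, (r a * φ a - g a) ^ 2 / r a ≤ 96 / 2 ^ 14 * μ := by
    refine (mul_le_mul_of_nonneg_left hgap.le (by positivity)).trans_eq ?_
    field_simp
  linarith
end

section
/- Let 0 < δ ≤ 1/8, let τ' be a real with 0 ≤ τ' ≤ δ, and set μ' := (1−τ')μ. Suppose for every a ∈ A: x_a s_a ≤ (1+δ)μ and 0 < r_a ≤ 2 s_a/x_a. Then for all φ, g ∈ ℝ^A, Σ_{a∈A} x_a·|r_a φ_a − g_a| / μ' ≤ 2·√( (Σ_{a∈A} (r_a φ_a − g_a)²/r_a) · m / μ ). (Cauchy–Schwarz estimate for the first summand in the proof of Lemma 3.2.) -/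
/-- Cauchy–Schwarz estimate for the first summand in the proof of Lemma 3.2. -/
theorem stmt_12 (ι : Type*) [Fintype ι] [Nonempty ι]
    (μ δ τ' μ' : ℝ) (hμ : 0 < μ) (hδ0 : 0 < δ) (hδ : δ ≤ 1/8)
    (hτ0 : 0 ≤ τ') (hτ : τ' ≤ δ) (hμ' : μ' = (1 - τ') * μ)
    (x s r : ι → ℝ) (hx : ∀ a, 0 < x a) (hs : ∀ a, 0 < s a)
    (hxs : ∀ a, x a * s a ≤ (1 + δ) * μ)
    (hr0 : ∀ a, 0 < r a) (hr : ∀ a, r a ≤ 2 * (s a / x a))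
    (φ g : ι → ℝ) :
    ∑ a, x a * |r a * φ a - g a| / μ' ≤
      2 * Real.sqrt ((∑ a, (r a * φ a - g a) ^ 2 / r a) * (Fintype.card ι : ℝ) / μ) := by
  have hμ'_ge : 7 / 8 * μ ≤ μ' := by rw [hμ']; gcongr; linarith
  have hμ'_pos : 0 < μ' := by linarith
  set E := ∑ a, (r a * φ a - g a) ^ 2 / r a
  have hE0 : 0 ≤ E := Finset.sum_nonneg fun a _ => div_nonneg (sq_nonneg _) (hr0 a).le
  have hterm : ∀ a, x a ^ 2 * r a ≤ 9 / 4 * μ := fun a => by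
    have hx_ne := (hx a).ne'
    calc x a ^ 2 * r a ≤ x a ^ 2 * (2 * (s a / x a)) := by gcongr; exact hr a
      _ = 2 * (x a * s a) := by field_simp
      _ ≤ 9 / 4 * μ := by nlinarith [hxs a]
  have hsum : ∑ a, x a ^ 2 * r a ≤ Fintype.card ι * (9 / 4 * μ) := by
    simpa using Finset.sum_le_card_nsmul Finset.univ _ _ fun a _ => hterm a
  have hCS : (∑ a, x a * |r a * φ a - g a|) ^ 2 ≤ (∑ a, x a ^ 2 * r a) * E := by
    refine Finset.sum_sq_le_sum_mul_sum_of_sq_le_mul _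
      (fun a _ => mul_nonneg (sq_nonneg _) (hr0 a).le)
      (fun a _ => div_nonneg (sq_nonneg _) (hr0 a).le) fun a _ => le_of_eq ?_
    have hr_ne := (hr0 a).ne'
    rw [mul_pow, sq_abs]
    field_simp
  rw [← Finset.sum_div, div_le_iff₀ hμ'_pos]
  refine (sq_le_sq₀ (Finset.sum_nonneg fun a _ => mul_nonneg (hx a).le (abs_nonneg _))
    (by positivity)).mp ?_
  rw [mul_pow, mul_pow, Real.sq_sqrt (by positivity)]
  calc (∑ a, x a * |r a * φ a - g a|) ^ 2
      ≤ Fintype.card ι * (9 / 4 * μ) * E := hCS.trans (by gcongr)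
    _ ≤ 2 ^ 2 * (E * Fintype.card ι / μ) * (7 / 8 * μ) ^ 2 := by
        have hnonneg : 0 ≤ Fintype.card ι * μ * E := by positivity
        have heq : 2 ^ 2 * (E * Fintype.card ι / μ) * (7 / 8 * μ) ^ 2
            = 49 / 16 * (Fintype.card ι * μ * E) := by
          field_simp
          ring
        rw [heq]
        linarith
    _ ≤ 2 ^ 2 * (E * Fintype.card ι / μ) * μ' ^ 2 := by gcongr
end

section
/- Define the tree condition number tcn := Σ_{a∈B} R_a/r_a, the sampling probabilities p_a := R_a/(tcn·r_a), the rounded step sizes α_a := round(Λ_a/R_a) (rounding to the nearest integer), and the gap := Σ_{a∈B} Λ_a²/r_a. If Σ_{a∈B} R_a²/r_a ≤ gap, then the expected change in electrical energy of one cycle update, Σ_{a∈B} p_a·(α_a²·R_a − 2·α_a·Λ_a), is at most −3·gap/(4·tcn); i.e., the expected decrease in energy is at least 3·gap/(4·tcn). (Expected energy decrease per cycle update in the centering step, with integer-rounded step sizes.) -/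
/-- Rounding the optimal step `L / R` to the nearest integer loses at most `R ^ 2 / 4`. -/
theorem mul_round_step_le {R : ℝ} (hR : 0 < R) (L : ℝ) :
    R * ((round (L / R) : ℝ) ^ 2 * R - 2 * (round (L / R) : ℝ) * L) ≤ R ^ 2 / 4 - L ^ 2 := by
  have hL : L = L / R * R := by field_simp
  have hsq : (L / R - round (L / R)) ^ 2 ≤ (1 / 2) ^ 2 :=
    sq_le_sq' (abs_le.mp (abs_sub_round (L / R))).1 (abs_le.mp (abs_sub_round (L / R))).2
  generalize (round (L / R) : ℝ) = n at *
  generalize L / R = x at *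
  subst hL
  nlinarith [mul_le_mul_of_nonneg_right hsq (sq_nonneg R)]

/-- Expected energy decrease per cycle update in the centering step with
integer-rounded step sizes: if `Σ R_a²/r_a ≤ gap`, the expected change in energy
is at most `-3·gap/(4·tcn)`. -/
theorem stmt_13 (B : Type*) [Fintype B] [Nonempty B]
    (r R Λ : B → ℝ) (hr : ∀ a, 0 < r a) (hR : ∀ a, 0 < R a) (hrR : ∀ a, r a ≤ R a)
    (tcn : ℝ) (htcn : tcn = ∑ a, R a / r a)
    (p : B → ℝ) (hp : ∀ a, p a = R a / (tcn * r a))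
    (α : B → ℝ) (hα : ∀ a, α a = (round (Λ a / R a) : ℝ))
    (gap : ℝ) (hgap : gap = ∑ a, (Λ a) ^ 2 / r a)
    (hcond : ∑ a, (R a) ^ 2 / r a ≤ gap) :
    ∑ a, p a * ((α a) ^ 2 * R a - 2 * α a * Λ a) ≤ -3 * gap / (4 * tcn) := by
  have htcn_pos : 0 < tcn := by
    rw [htcn]
    exact Finset.sum_pos (fun a _ => div_pos (hR a) (hr a)) Finset.univ_nonempty
  have hterm : ∀ a, p a * ((α a) ^ 2 * R a - 2 * α a * Λ a)
      ≤ ((R a) ^ 2 / r a / 4 - (Λ a) ^ 2 / r a) / tcn := by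
    intro a
    have hra := hr a
    calc p a * ((α a) ^ 2 * R a - 2 * α a * Λ a)
        = R a * ((α a) ^ 2 * R a - 2 * α a * Λ a) / (tcn * r a) := by rw [hp]; ring
      _ ≤ ((R a) ^ 2 / 4 - (Λ a) ^ 2) / (tcn * r a) := by
        rw [hα]
        gcongr
        exact mul_round_step_le (hR a) (Λ a)
      _ = ((R a) ^ 2 / r a / 4 - (Λ a) ^ 2 / r a) / tcn := by field_simp
  calc ∑ a, p a * ((α a) ^ 2 * R a - 2 * α a * Λ a)
      ≤ ∑ a, ((R a) ^ 2 / r a / 4 - (Λ a) ^ 2 / r a) / tcn :=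
        Finset.sum_le_sum fun a _ => hterm a
    _ = ((∑ a, (R a) ^ 2 / r a) / 4 - gap) / tcn := by
        rw [← Finset.sum_div, Finset.sum_sub_distrib, ← Finset.sum_div, ← hgap]
    _ ≤ (gap / 4 - gap) / tcn := by gcongr
    _ = -3 * gap / (4 * tcn) := by field_simp; ring
end

section
/- Let A be a nonempty finite index set with m := |A| ≥ 1, let δ > 0 and M > 0 be reals, let t be a real with t > 0 and t ≥ M·(m/δ − 1), and set μ₀ := t + M. If x, s ∈ ℝ^A satisfy t ≤ x_a·s_a ≤ t + M for every a ∈ A, then Σ_{a∈A} |x_a s_a/μ₀ − 1| ≤ δ. (Lemma A.1, part 2: the constructed initial points are δ-close to the central path at μ₀.) -/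
/-- Lemma A.1, part 2: if `t ≥ M(m/δ - 1)` and `x_a s_a ∈ [t, t + M]` for all `a`,
then the points are δ-close to the central path at `μ₀ = t + M`. -/
theorem stmt_15 (ι : Type*) [Fintype ι] [Nonempty ι]
    (δ M t μ₀ : ℝ) (hδ : 0 < δ) (hM : 0 < M) (ht0 : 0 < t)
    (ht : M * ((Fintype.card ι : ℝ) / δ - 1) ≤ t) (hμ₀ : μ₀ = t + M)
    (x s : ι → ℝ) (hxs : ∀ a, t ≤ x a * s a ∧ x a * s a ≤ t + M) :
    ∑ a, |x a * s a / μ₀ - 1| ≤ δ := by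
  subst hμ₀
  have hμ : 0 < t + M := add_pos ht0 hM
  have hterm : ∀ a ∈ Finset.univ, |x a * s a / (t + M) - 1| ≤ M / (t + M) := by
    intro a _
    obtain ⟨hl, hu⟩ := hxs a
    rw [div_sub_one hμ.ne', abs_div, abs_of_pos hμ]
    gcongr
    rw [abs_le]
    constructor <;> linarith
  have hcard : M * (Fintype.card ι : ℝ) ≤ (t + M) * δ := by
    rw [← div_le_iff₀ hδ, mul_div_assoc]
    linarith
  calc ∑ a, |x a * s a / (t + M) - 1|
      ≤ Finset.univ.card • (M / (t + M)) := Finset.sum_le_card_nsmul _ _ _ hterm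
    _ = M * (Fintype.card ι : ℝ) / (t + M) := by
        rw [nsmul_eq_mul, Finset.card_univ]
        ring
    _ ≤ δ := by
        rw [div_le_iff₀ hμ]
        linarith
end
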